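/- For any word u of length n ≥ 1, let A be the sum of |H(v)| over all runs v in u with shortest period 1, and let B be the sum of |H(v)| over all runs v in u with shortest period at least 2. Then A + B/2 < n. -/

import Mathlib

open scoped Classical

namespace RunsExp

variable {α : Type*}

/-- `p` is a period of the word `w`. -/
def IsPeriod (w : List α) (p : ℕ) : Prop :=
  0 < p ∧ ∀ i : ℕ, i + p < w.length → w[i]? = w[i + p]?

/-- The shortest period of the word `w`. -/
noncomputable def minPeriod (w : List α) : ℕ := sInf {p | IsPeriod w p}

/-- The factor `u[i..j]` of `u` (0-based indices, inclusive on both ends). -/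
def factor (u : List α) (i j : ℕ) : List α := (u.drop i).take (j - i + 1)

/-- `[i..j]` is a run in `u` (0-based indices): the shortest period `p` of `u[i..j]`
satisfies `2p ≤ j-i+1` and the interval can be extended neither to the left nor to
the right without violating this property. -/
def IsRun (u : List α) (i j : ℕ) : Prop :=
  i ≤ j ∧ j < u.length ∧
  2 * minPeriod (factor u i j) ≤ j - i + 1 ∧
  (i = 0 ∨ u[i - 1]? ≠ u[i + minPeriod (factor u i j) - 1]?) ∧
  (j = u.length - 1 ∨ u[j - minPeriod (factor u i j) + 1]? ≠ u[j + 1]?)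

/-- The exponent of the run `[i..j]` of `u`. -/
noncomputable def exponent (u : List α) (i j : ℕ) : ℚ :=
  ((j : ℚ) - (i : ℚ) + 1) / (minPeriod (factor u i j) : ℚ)

/-- The set of all runs of `u`, as a finset of pairs of indices. -/
noncomputable def runs (u : List α) : Finset (ℕ × ℕ) :=
  (Finset.range u.length ×ˢ Finset.range u.length).filter fun q => IsRun u q.1 q.2

/-- The sum of exponents of all runs in `u`. -/
noncomputable def sigma (u : List α) : ℚ :=
  ∑ q ∈ runs u, exponent u q.1 q.2

/-- The lexicographically minimal word cyclically equivalent to `w`. -/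
noncomputable def minRot [LinearOrder α] (w : List α) : List α :=
  ((List.range w.length).map w.rotate).foldr min w

/-- The lexicographically maximal word cyclically equivalent to `w`. -/
noncomputable def maxRot [LinearOrder α] (w : List α) : List α :=
  ((List.range w.length).map w.rotate).foldr max w

/-- The word `x` occurs in `u` at (0-based) starting position `s`, entirely within
the interval `[i..j]`. -/
def OccursAt (u : List α) (i j : ℕ) (x : List α) (s : ℕ) : Prop :=
  i ≤ s ∧ s + x.length ≤ j + 1 ∧ factor u s (s + x.length - 1) = x

/-- `s` and `s'` are starting positions of consecutive occurrences of `x`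
inside the interval `[i..j]` of `u`. -/
def ConsecutiveOcc (u : List α) (i j : ℕ) (x : List α) (s s' : ℕ) : Prop :=
  OccursAt u i j x s ∧ OccursAt u i j x s' ∧ s < s' ∧
    ∀ t, s < t → t < s' → ¬ OccursAt u i j x t

/-- The set of handles of the run `[i..j]` of `u`: inter-position `k` lies between
the letters at positions `k` and `k+1`.  If the minimal and maximal rotations of the
period-prefix `w` coincide, all inter-positions inside the run are handles; otherwise
the handles are the inter-positions between consecutive occurrences of the minimal
rotation and between consecutive occurrences of the maximal rotation. -/
noncomputable def handles [LinearOrder α] (u : List α) (i j : ℕ) : Set ℕ :=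
  let p := minPeriod (factor u i j)
  let w := factor u i (i + p - 1)
  if minRot w = maxRot w then
    {k | i ≤ k ∧ k < j}
  else
    {k | ∃ s s', (ConsecutiveOcc u i j (minRot w) s s' ∨
                  ConsecutiveOcc u i j (maxRot w) s s') ∧ k = s' - 1}

/-- `[i..j]` is a cubic run in `u`. -/
def IsCubicRun (u : List α) (i j : ℕ) : Prop :=
  IsRun u i j ∧ 3 * minPeriod (factor u i j) ≤ j - i + 1

/-- The set of all cubic runs of `u`. -/
noncomputable def cubicRuns (u : List α) : Finset (ℕ × ℕ) :=
  (Finset.range u.length ×ˢ Finset.range u.length).filter fun q => IsCubicRun u q.1 q.2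

/-- The sum of exponents of all cubic runs in `u`. -/
noncomputable def sigmaCubic (u : List α) : ℚ :=
  ∑ q ∈ cubicRuns u, exponent u q.1 q.2



lemma factor_getElem? (u : List α) (i j t : ℕ) :
    (factor u i j)[t]? = if t < j - i + 1 then u[i + t]? else none := by
  unfold factor
  rw [List.getElem?_take]
  simp [List.getElem?_drop]

lemma factor_length (u : List α) (i j : ℕ) (hij : i ≤ j) (hj : j < u.length) :
    (factor u i j).length = j - i + 1 := by
  unfold factor
  simp
  omega

lemma isPeriod_factor (u : List α) (i j p : ℕ) (hij : i ≤ j) (hj : j < u.length) :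
    IsPeriod (factor u i j) p ↔ 0 < p ∧ ∀ s, i ≤ s → s + p ≤ j → u[s]? = u[s + p]? := by
  unfold IsPeriod
  rw [factor_length u i j hij hj]
  refine and_congr_right fun _ => ⟨fun h s h1 h2 => ?_, fun h t ht => ?_⟩
  · have := h (s - i) (by omega)
    rw [factor_getElem?, factor_getElem?, if_pos (by omega), if_pos (by omega)] at this
    rw [show i + (s - i) = s by omega, show i + (s - i + p) = s + p by omega] at this
    exact this
  · rw [factor_getElem?, factor_getElem?, if_pos (by omega), if_pos (by omega)]
    rw [h (i + t) (by omega) (by omega), Nat.add_assoc]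

lemma minPeriod_spec (u : List α) (i j : ℕ) (hij : i ≤ j) (hj : j < u.length) :
    IsPeriod (factor u i j) (minPeriod (factor u i j)) := by
  have : (minPeriod (factor u i j)) ∈ {p | IsPeriod (factor u i j) p} := by
    apply Nat.sInf_mem
    refine ⟨(factor u i j).length, ?_⟩
    constructor
    · rw [factor_length u i j hij hj]; omega
    · intro t ht; omega
  exact this

lemma minPeriod_le (w : List α) (p : ℕ) (h : IsPeriod w p) : minPeriod w ≤ p :=
  Nat.sInf_le h

lemma period_mod (u : List α) (i j p : ℕ)
    (h : ∀ s, i ≤ s → s + p ≤ j → u[s]? = u[s + p]?) :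
    ∀ t, i + t ≤ j → u[i + t]? = u[i + t % p]? := by
  intro t
  induction t using Nat.strong_induction_on with
  | _ t ih =>
    intro ht
    by_cases hp0 : p = 0
    · simp [hp0]
    by_cases hlt : t < p
    · rw [Nat.mod_eq_of_lt hlt]
    · have h1 := ih (t - p) (by omega) (by omega)
      have h2 := h (i + (t - p)) (by omega) (by omega)
      rw [show i + (t - p) + p = i + t by omega] at h2
      rw [← h2, h1, ← Nat.mod_eq_sub_mod (a := t) (by omega)]

/-- The period prefix of a run is primitive. -/
lemma primitive (u : List α) (i j : ℕ) (hij : i ≤ j) (hj : j < u.length)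
    (h2 : minPeriod (factor u i j) ≤ j - i + 1) (d : ℕ) (hd : 0 < d)
    (hdp : d < minPeriod (factor u i j)) :
    (factor u i (i + minPeriod (factor u i j) - 1)).rotate d ≠
      factor u i (i + minPeriod (factor u i j) - 1) := by
  intro heq
  have hs := minPeriod_spec u i j hij hj
  generalize hp : minPeriod (factor u i j) = p at *
  have hs' := ((isPeriod_factor u i j p hij hj).1 hs).2
  have hm := period_mod u i j p hs'
  have hlen : (factor u i (i + p - 1)).length = p := by
    rw [factor_length _ _ _ (by omega) (by omega)]; omega
  have hper : IsPeriod (factor u i j) d := by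
    rw [isPeriod_factor u i j d hij hj]
    refine ⟨hd, fun s h1 h3 => ?_⟩
    have e1 := hm (s - i) (by omega)
    have e2 := hm (s + d - i) (by omega)
    rw [show i + (s - i) = s by omega] at e1
    rw [show i + (s + d - i) = s + d by omega] at e2
    rw [e1, e2]
    have hlt : (s - i) % p < p := Nat.mod_lt _ (by omega)
    have hlt' : (s + d - i) % p < p := Nat.mod_lt _ (by omega)
    have e3 := congrArg (fun l => l[(s - i) % p]?) heq
    rw [List.getElem?_rotate (by omega), hlen, factor_getElem?, factor_getElem?,
      if_pos (by have := Nat.mod_lt ((s - i) % p + d) (show 0 < p by omega); omega),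
      if_pos (by omega)] at e3
    have hmm : ((s - i) % p + d) % p = (s + d - i) % p := by
      rw [show s + d - i = s - i + d by omega, Nat.mod_add_mod]
    rw [← e3, hmm]
  have := minPeriod_le _ _ hper
  omega

lemma foldr_min_le {β : Type*} [LinearOrder β] (l : List β) (w : β) :
    (∀ y ∈ l, l.foldr min w ≤ y) ∧ (l.foldr min w = w ∨ l.foldr min w ∈ l) := by
  induction l with
  | nil => simp
  | cons a l ih =>
    simp only [List.foldr_cons, List.mem_cons]
    refine ⟨?_, ?_⟩
    · rintro y (rfl | hy)
      · exact min_le_left _ _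
      · exact (min_le_right _ _).trans (ih.1 y hy)
    · rcases min_choice a (l.foldr min w) with h | h <;> rw [h] <;> tauto

lemma foldr_max_le {β : Type*} [LinearOrder β] (l : List β) (w : β) :
    (∀ y ∈ l, y ≤ l.foldr max w) ∧ (l.foldr max w = w ∨ l.foldr max w ∈ l) := by
  induction l with
  | nil => simp
  | cons a l ih =>
    simp only [List.foldr_cons, List.mem_cons]
    refine ⟨?_, ?_⟩
    · rintro y (rfl | hy)
      · exact le_max_left _ _
      · exact (ih.1 y hy).trans (le_max_right _ _)
    · rcases max_choice a (l.foldr max w) with h | h <;> rw [h] <;> tauto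

lemma mem_rots (w : List α) (hw : 0 < w.length) (m : ℕ) :
    w.rotate m ∈ (List.range w.length).map w.rotate := by
  rw [List.mem_map]
  exact ⟨m % w.length, by simpa using Nat.mod_lt _ hw, List.rotate_mod _ _⟩

lemma minRot_spec [LinearOrder α] (w : List α) (hw : 0 < w.length) :
    (∀ m, minRot w ≤ w.rotate m) ∧ ∃ d, minRot w = w.rotate d := by
  have h := foldr_min_le ((List.range w.length).map w.rotate) w
  refine ⟨fun m => h.1 _ (mem_rots w hw m), ?_⟩
  rcases h.2 with h | h
  · exact ⟨0, by rw [List.rotate_zero]; exact h⟩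
  · obtain ⟨d, -, hd⟩ := List.mem_map.1 h
    exact ⟨d, hd.symm⟩

lemma maxRot_spec [LinearOrder α] (w : List α) (hw : 0 < w.length) :
    (∀ m, w.rotate m ≤ maxRot w) ∧ ∃ d, maxRot w = w.rotate d := by
  have h := foldr_max_le ((List.range w.length).map w.rotate) w
  refine ⟨fun m => h.1 _ (mem_rots w hw m), ?_⟩
  rcases h.2 with h | h
  · exact ⟨0, by rw [List.rotate_zero]; exact h⟩
  · obtain ⟨d, -, hd⟩ := List.mem_map.1 h
    exact ⟨d, hd.symm⟩

lemma lt_append_left [LinearOrder α] (y : List α) {z z' : List α} (h : z < z') :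
    y ++ z < y ++ z' := by
  induction y with
  | nil => simpa
  | cons a y ih => 
    simp only [List.cons_append]
    exact List.cons_lt_cons_iff.2 (Or.inr ⟨rfl, ih⟩)

lemma lt_append_right [LinearOrder α] (y y' : List α) : ∀ {z z' : List α},
    z.length = z'.length → z < z' → z ++ y < z' ++ y'
  | [], [], _, h => absurd h (lt_irrefl _)
  | a :: z, b :: z', hl, h => by
    simp only [List.cons_append]
    rcases List.cons_lt_cons_iff.1 h with h0 | ⟨h1, h0⟩
    · exact List.cons_lt_cons_iff.2 (Or.inl h0)
    · exact List.cons_lt_cons_iff.2 (Or.inr ⟨h1, lt_append_right y y' (by simpa using hl) h0⟩)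

/-- An extremal conjugate of a primitive word is unbordered. -/
lemma unbordered [LinearOrder α] (x : List α)
    (hx : (∀ m, x ≤ x.rotate m) ∨ (∀ m, x.rotate m ≤ x))
    (hprim : ∀ d, 0 < d → d < x.length → x.rotate d ≠ x)
    (b : ℕ) (hb : 0 < b) (hbl : b < x.length) : x.take b ≠ x.drop (x.length - b) := by
  intro heq
  have e1 : x = x.take b ++ x.drop b := (List.take_append_drop _ _).symm
  have e2 : x = x.take (x.length - b) ++ x.take b := by
    rw [heq, List.take_append_drop]
  have r1 : x.rotate b = x.drop b ++ x.take b := List.rotate_eq_drop_append_take hbl.le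
  have r2 : x.rotate (x.length - b) = x.take b ++ x.take (x.length - b) := by
    rw [List.rotate_eq_drop_append_take (by omega), heq]
  have hl : (x.drop b).length = (x.take (x.length - b)).length := by
    simp
  rcases lt_trichotomy (x.drop b) (x.take (x.length - b)) with h | h | h
  · have a1 := lt_append_right (x.take b) (x.take b) hl h
    have a2 := lt_append_left (x.take b) h
    rw [← r1, ← e2] at a1
    rw [← r2, ← e1] at a2
    rcases hx with hx | hx
    · exact absurd (hx b) (not_le.2 a1)
    · exact absurd (hx _) (not_le.2 a2)
  · apply hprim b hb hbl
    rw [r1, h, ← e2]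
  · have a1 := lt_append_right (x.take b) (x.take b) hl.symm h
    have a2 := lt_append_left (x.take b) h
    rw [← r1, ← e2] at a1
    rw [← r2, ← e1] at a2
    rcases hx with hx | hx
    · exact absurd (hx _) (not_le.2 a2)
    · exact absurd (hx b) (not_le.2 a1)

/-- There is a square of an unbordered word of length `p` centered at `k`, inside `[i..j]`. -/
def Centered (u : List α) (i j p k : ℕ) : Prop :=
  i + p ≤ k + 1 ∧ k + p ≤ j ∧ 
  ∀ b, 0 < b → b < p → ∃ t, t < b ∧ u[k + 1 + t]? ≠ u[k + 1 + p - b + t]?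

lemma extremal_aux [LinearOrder α] (u : List α) (i j : ℕ) (hrun : IsRun u i j) (x : List α)
    (hrot : ∃ d, x = (factor u i (i + minPeriod (factor u i j) - 1)).rotate d)
    (hx : (∀ m, x ≤ x.rotate m) ∨ (∀ m, x.rotate m ≤ x))
    (s s' : ℕ) (hc : ConsecutiveOcc u i j x s s') :
    Centered u i j (minPeriod (factor u i j)) (s' - 1) := by
  obtain ⟨hij, hj, h2, -, -⟩ := hrun
  have hprim := primitive u i j hij hj (by omega)
  have hs := (isPeriod_factor u i j _ hij hj).1 (minPeriod_spec u i j hij hj)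
  generalize hp : minPeriod (factor u i j) = p at *
  have hlen : (factor u i (i + p - 1)).length = p := by
    rw [factor_length _ _ _ (by omega) (by omega)]; omega
  obtain ⟨d, hd⟩ := hrot
  have hxl : x.length = p := by rw [hd, List.length_rotate, hlen]
  have hprimx : ∀ d, 0 < d → d < x.length → x.rotate d ≠ x := by
    intro e he hel h
    apply hprim e he (by omega)
    rw [hd, List.rotate_rotate, Nat.add_comm d e, ← List.rotate_rotate] at h
    exact List.rotate_injective d h
  have hub := unbordered x hx hprimx
  obtain ⟨⟨ha1, ha2, ha3⟩, ⟨hb1, hb2, hb3⟩, hss, hno⟩ := hc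
  rw [hxl] at ha2 ha3 hb2 hb3 hub
  have hxs : ∀ t, t < p → x[t]? = u[s + t]? := by
    intro t ht
    rw [← ha3, factor_getElem?, if_pos (by omega)]
  have hxs' : ∀ t, t < p → x[t]? = u[s' + t]? := by
    intro t ht
    rw [← hb3, factor_getElem?, if_pos (by omega)]
  have hub' : ∀ b, 0 < b → b < p → ∃ t, t < b ∧ x[t]? ≠ x[p - b + t]? := by
    intro b hb hbp
    by_contra hcon
    push Not at hcon
    apply hub b hb hbp
    apply List.ext_getElem?
    intro t
    rw [List.getElem?_take, List.getElem?_drop]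
    split_ifs with h
    · exact hcon t h
    · rw [List.getElem?_eq_none (by omega)]
  have hge : s + p ≤ s' := by
    by_contra hlt
    obtain ⟨t, ht, hne⟩ := hub' (p - (s' - s)) (by omega) (by omega)
    apply hne
    rw [hxs' t (by omega), hxs _ (by omega)]
    congr 1; omega
  have hle : s' ≤ s + p := by
    by_contra hlt
    apply hno (s + p) (by omega) (by omega)
    refine ⟨by omega, by omega, ?_⟩
    rw [hxl]
    apply List.ext_getElem?
    intro t
    rw [factor_getElem?]
    split_ifs with h
    · rw [hxs t (by omega), hs.2 (s + t) (by omega) (by omega)]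
      congr 1; omega
    · rw [List.getElem?_eq_none (by omega)]
  refine ⟨by omega, by omega, fun b hb hbp => ?_⟩
  obtain ⟨t, ht, hne⟩ := hub' b hb hbp
  refine ⟨t, ht, ?_⟩
  rw [hxs' t (by omega), hxs' _ (by omega)] at hne
  rw [show s' - 1 + 1 + t = s' + t by omega, show s' - 1 + 1 + p - b + t = s' + (p - b + t) by omega]
  exact hne

lemma handles_centered [LinearOrder α] (u : List α) (i j k : ℕ) (hrun : IsRun u i j)
    (hk : k ∈ handles u i j) : Centered u i j (minPeriod (factor u i j)) k := by
  have hrun' := hrun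
  obtain ⟨hij, hj, h2, -, -⟩ := hrun
  have hprim := primitive u i j hij hj (by omega)
  have hs := (isPeriod_factor u i j _ hij hj).1 (minPeriod_spec u i j hij hj)
  have hlen : (factor u i (i + minPeriod (factor u i j) - 1)).length
      = minPeriod (factor u i j) := by
    rw [factor_length _ _ _ (by omega) (by omega)]; omega
  have hmin := minRot_spec (factor u i (i + minPeriod (factor u i j) - 1)) (by omega)
  have hmax := maxRot_spec (factor u i (i + minPeriod (factor u i j) - 1)) (by omega)
  unfold handles at hk
  simp only at hk
  split_ifs at hk with heq
  · have hp1 : minPeriod (factor u i j) = 1 := by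
      by_contra hne
      apply hprim 1 one_pos (by omega)
      have h0 := (hmin.1 0).antisymm (heq ▸ hmax.1 0)
      have h1 := (hmin.1 1).antisymm (heq ▸ hmax.1 1)
      rw [← h1, h0, List.rotate_zero]
    obtain ⟨h1, h3⟩ := hk
    rw [hp1]
    exact ⟨by omega, by omega, fun b hb hb1 => by omega⟩
  · obtain ⟨s, s', hc, rfl⟩ := hk
    rcases hc with hc | hc
    · refine extremal_aux u i j hrun' _ hmin.2 (Or.inl fun m => ?_) s s' hc
      obtain ⟨d, hd⟩ := hmin.2
      conv_rhs => rw [hd, List.rotate_rotate]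
      exact hmin.1 _
    · refine extremal_aux u i j hrun' _ hmax.2 (Or.inr fun m => ?_) s s' hc
      obtain ⟨d, hd⟩ := hmax.2
      conv_lhs => rw [hd, List.rotate_rotate]
      exact hmax.1 _

lemma centered_lt_false (u : List α) (i j i' j' p p' k : ℕ)
    (hs : ∀ s, i ≤ s → s + p ≤ j → u[s]? = u[s + p]?)
    (hs' : ∀ s, i' ≤ s → s + p' ≤ j' → u[s]? = u[s + p']?)
    (hp : 0 < p) (h : Centered u i j p k) (h' : Centered u i' j' p' k) (hlt : p < p') :
    False := by
  obtain ⟨a1, a2, a3⟩ := h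
  obtain ⟨b1, b2, b3⟩ := h'
  obtain ⟨t, ht, hne⟩ := b3 p hp hlt
  apply hne
  have e1 := hs (k + 1 + t - p) (by omega) (by omega)
  have e2 := hs' (k + 1 + t - p) (by omega) (by omega)
  rw [show k + 1 + t - p + p = k + 1 + t by omega] at e1
  rw [show k + 1 + t - p + p' = k + 1 + p' - p + t by omega] at e2
  rw [← e1, e2]

/-- Two runs of equal period sharing a centered square coincide. -/
lemma run_le (u : List α) (i j i' j' p k : ℕ) (hj : j < u.length) (hj' : j' < u.length)
    (hp : 0 < p)
    (hs : ∀ s, i ≤ s → s + p ≤ j → u[s]? = u[s + p]?)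
    (hl' : i' = 0 ∨ u[i' - 1]? ≠ u[i' + p - 1]?)
    (hr' : j' = u.length - 1 ∨ u[j' - p + 1]? ≠ u[j' + 1]?)
    (h : Centered u i j p k) (h' : Centered u i' j' p k) : i' ≤ i ∧ j ≤ j' := by
  obtain ⟨a1, a2, -⟩ := h
  obtain ⟨b1, b2, -⟩ := h'
  constructor
  · by_contra hlt
    rcases hl' with h | h
    · omega
    · apply h
      rw [hs (i' - 1) (by omega) (by omega)]
      congr 1; omega
  · by_contra hlt
    rcases hr' with h | h
    · omega
    · apply h
      rw [hs (j' - p + 1) (by omega) (by omega)]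
      congr 1; omega

lemma handles_unique [LinearOrder α] (u : List α) (i j i' j' k : ℕ) (hrun : IsRun u i j)
    (hrun' : IsRun u i' j') (hk : k ∈ handles u i j) (hk' : k ∈ handles u i' j') :
    i = i' ∧ j = j' := by
  have c := handles_centered u i j k hrun hk
  have c' := handles_centered u i' j' k hrun' hk'
  obtain ⟨hij, hj, h2, hl, hr⟩ := hrun
  obtain ⟨hij', hj', h2', hl', hr'⟩ := hrun'
  obtain ⟨hp, hs⟩ := (isPeriod_factor u i j _ hij hj).1 (minPeriod_spec u i j hij hj)
  obtain ⟨hp', hs'⟩ := (isPeriod_factor u i' j' _ hij' hj').1 (minPeriod_spec u i' j' hij' hj')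
  have hpp : minPeriod (factor u i' j') = minPeriod (factor u i j) := by
    rcases lt_trichotomy (minPeriod (factor u i j)) (minPeriod (factor u i' j')) with h | h | h
    · exact (centered_lt_false u i j i' j' _ _ k hs hs' hp c c' h).elim
    · exact h.symm
    · exact (centered_lt_false u i' j' i j _ _ k hs' hs hp' c' c h).elim
  rw [hpp] at hs' hl' hr' c'
  have r1 := run_le u i j i' j' _ k hj hj' hp hs hl' hr' c c'
  have r2 := run_le u i' j' i j _ k hj' hj hp hs' hl hr c' c
  omega

lemma handles_subset [LinearOrder α] (u : List α) (i j : ℕ) (hrun : IsRun u i j) :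
    handles u i j ⊆ (Finset.range (u.length - 1) : Set ℕ) := by
  intro k hk
  have c := handles_centered u i j k hrun hk
  obtain ⟨hij, hj, h2, hl, hr⟩ := hrun
  obtain ⟨hp, -⟩ := minPeriod_spec u i j hij hj
  obtain ⟨-, c2, -⟩ := c
  simp only [Finset.coe_range, Set.mem_Iio]
  omega

lemma sum_handles_le [LinearOrder α] (u : List α) :
    ∑ q ∈ runs u, (handles u q.1 q.2).ncard ≤ u.length - 1 := by
  have hfin : ∀ q ∈ runs u, (handles u q.1 q.2).Finite := fun q hq =>
    (Finset.finite_toSet _).subset (handles_subset u q.1 q.2 (Finset.mem_filter.1 hq).2)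
  let F : ℕ × ℕ → Finset ℕ := fun q =>
    (Finset.range (u.length - 1)).filter (fun k => k ∈ handles u q.1 q.2)
  have hF : ∀ q ∈ runs u, (handles u q.1 q.2).ncard = (F q).card := by
    intro q hq
    rw [← Set.ncard_coe_finset]
    congr 1
    ext k
    simp only [F, Finset.coe_filter, Set.mem_ofPred_eq]
    exact ⟨fun h => ⟨handles_subset u q.1 q.2 (Finset.mem_filter.1 hq).2 h, h⟩, fun h => h.2⟩
  rw [Finset.sum_congr rfl hF, ← Finset.card_biUnion]
  · calc _ ≤ (Finset.range (u.length - 1)).card := by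
          apply Finset.card_le_card
          intro k hk
          obtain ⟨q, -, hq⟩ := Finset.mem_biUnion.1 hk
          exact (Finset.mem_filter.1 hq).1
      _ = _ := Finset.card_range _
  · intro q hq q' hq' hne
    rw [Function.onFun, Finset.disjoint_left]
    intro k hk hk'
    apply hne
    have := handles_unique u q.1 q.2 q'.1 q'.2 k (Finset.mem_filter.1 hq).2
      (Finset.mem_filter.1 hq').2 (Finset.mem_filter.1 hk).2 (Finset.mem_filter.1 hk').2
    exact Prod.ext this.1 this.2

/-- If `A` is the total number of handles of runs with period `1` and `B` the total
number of handles of runs with period at least `2`, then `A + B/2 < n`. -/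
theorem sum_handles_period_one_add_half_lt [LinearOrder α] (u : List α)
    (hn : 1 ≤ u.length) :
    (∑ q ∈ (runs u).filter (fun q => minPeriod (factor u q.1 q.2) = 1),
        ((handles u q.1 q.2).ncard : ℚ)) +
    (∑ q ∈ (runs u).filter (fun q => 2 ≤ minPeriod (factor u q.1 q.2)),
        ((handles u q.1 q.2).ncard : ℚ)) / 2
      < (u.length : ℚ) := by
  have key : (∑ q ∈ runs u, ((handles u q.1 q.2).ncard : ℚ)) ≤ (u.length : ℚ) - 1 := by
    have h := sum_handles_le u
    have h' : (∑ q ∈ runs u, (handles u q.1 q.2).ncard) + 1 ≤ u.length := by omega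
    have h'' : (((∑ q ∈ runs u, (handles u q.1 q.2).ncard) + 1 : ℕ) : ℚ) ≤ (u.length : ℚ) :=
      Nat.cast_le.2 h'
    push_cast at h''
    linarith
  have hsplit : (∑ q ∈ (runs u).filter (fun q => minPeriod (factor u q.1 q.2) = 1),
        ((handles u q.1 q.2).ncard : ℚ)) +
    (∑ q ∈ (runs u).filter (fun q => 2 ≤ minPeriod (factor u q.1 q.2)),
        ((handles u q.1 q.2).ncard : ℚ)) ≤ ∑ q ∈ runs u, ((handles u q.1 q.2).ncard : ℚ) := by
    rw [← Finset.sum_union]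
    · apply Finset.sum_le_sum_of_subset_of_nonneg
      · intro q hq
        rcases Finset.mem_union.1 hq with h | h <;> exact (Finset.mem_filter.1 h).1
      · intros; positivity
    · rw [Finset.disjoint_left]
      intro q h1 h2
      have := (Finset.mem_filter.1 h1).2
      have := (Finset.mem_filter.1 h2).2
      omega
  have hB : 0 ≤ ∑ q ∈ (runs u).filter (fun q => 2 ≤ minPeriod (factor u q.1 q.2)),
        ((handles u q.1 q.2).ncard : ℚ) := Finset.sum_nonneg fun _ _ => by positivity
  linarith
end RunsExp
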